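/- arXiv:math/0301343 — 3 statements merged into one kernel-verified Lean document; each statement's English description precedes it below -/
import Mathlib

section
/- For all constants C₀ ≥ 1, c₁ > 0, C₁ ≥ 1 there exist ε > 0 and c > 0 such that: for every prime q, with F = ℤ/qℤ, if L is a collection of lines in F³ satisfying the Wolff axiom (for every affine 2-plane π ⊆ F³, the number of lines of L contained in π is at most C₀·|F|) and c₁·|F|² ≤ |L| ≤ C₁·|F|², and if P ⊆ F³ contains every line of L (i.e. l ⊆ P for all l ∈ L), then |P| ≥ c·|F|^{5/2 + ε}. -/
/-- A line in `F³`: the set `{x + t • v : t ∈ F}` for some point `x` and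
some non-zero direction `v`. -/
def IsSpaceLine (F : Type*) [CommRing F] (l : Set (Fin 3 → F)) : Prop :=
  ∃ x v : Fin 3 → F, v ≠ 0 ∧ l = {y | ∃ t : F, y = x + t • v}

/-- An affine 2-plane in `F³`: a coset of a two-dimensional linear subspace. -/
def IsAffinePlane (F : Type*) [CommRing F] (π : Set (Fin 3 → F)) : Prop :=
  ∃ (W : Submodule F (Fin 3 → F)) (x : Fin 3 → F),
    Module.finrank F W = 2 ∧ π = {y | y - x ∈ W}

/-- The univariate polynomial `t ↦ f (x + t v)`. -/
noncomputable def lineRestrict {σ R : Type*} [CommRing R] (x v : σ → R) :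
    MvPolynomial σ R →ₐ[R] Polynomial R :=
  MvPolynomial.aeval fun i => Polynomial.C (x i) + Polynomial.C (v i) * Polynomial.X

section LineRestrict

variable {σ R : Type*} [CommRing R] (x v : σ → R) (f : MvPolynomial σ R)

theorem natDegree_lineRestrict_le : (lineRestrict x v f).natDegree ≤ f.totalDegree := by
  have h := MvPolynomial.aeval_natDegree_le (n := 1) f le_rfl
    (fun i => Polynomial.C (x i) + Polynomial.C (v i) * Polynomial.X) fun i => by compute_degree
  simpa [lineRestrict] using h

theorem eval_lineRestrict (t : R) :
    (lineRestrict x v f).eval t = MvPolynomial.eval (x + t • v) f := by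
  induction f using MvPolynomial.induction_on with
  | C a => simp [lineRestrict]
  | add p q hp hq => simp [hp, hq]
  | mul_X p i hp => rw [map_mul, Polynomial.eval_mul, hp]; simp [lineRestrict, mul_comm t]

theorem derivative_lineRestrict [Fintype σ] :
    (lineRestrict x v f).derivative =
      ∑ i, Polynomial.C (v i) * lineRestrict x v (MvPolynomial.pderiv i f) := by
  classical
  induction f using MvPolynomial.induction_on with
  | C a => simp [lineRestrict]
  | add p q hp hq => simp [hp, hq, mul_add, Finset.sum_add_distrib]
  | mul_X p i hp =>
    have hX : lineRestrict x v (MvPolynomial.X i) =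
      Polynomial.C (x i) + Polynomial.C (v i) * Polynomial.X := by simp [lineRestrict]
    have hs : ∀ k, Polynomial.C (v k) * lineRestrict x v (MvPolynomial.pderiv k
          (p * MvPolynomial.X i)) =
        Polynomial.C (v k) * lineRestrict x v (MvPolynomial.pderiv k p) *
          lineRestrict x v (MvPolynomial.X i) +
        if k = i then Polynomial.C (v k) * lineRestrict x v p else 0 := by
      intro k
      rw [MvPolynomial.pderiv_mul, MvPolynomial.pderiv_X, map_add, map_mul, map_mul]
      by_cases hk : k = i
      · subst hk; simp; ring
      · simp [hk, Ne.symm hk, mul_assoc]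
    simp only [hs, Finset.sum_add_distrib, ← Finset.sum_mul, ← hp, map_mul]
    simp [hX, Polynomial.derivative_mul]
    ring

theorem lineRestrict_eq_zero [IsDomain R] [Fintype R]
    (hd : f.totalDegree < Fintype.card R) (hf : ∀ t : R, MvPolynomial.eval (x + t • v) f = 0) :
    lineRestrict x v f = 0 :=
  Polynomial.eq_zero_of_natDegree_lt_card_of_eval_eq_zero _ Function.injective_id
    (fun t => by simpa [eval_lineRestrict] using hf t)
    ((natDegree_lineRestrict_le x v f).trans_lt hd)

end LineRestrict

theorem MvPolynomial.totalDegree_pderiv_lt {σ R : Type*} [CommRing R] (f : MvPolynomial σ R)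
    (i : σ) (h : pderiv i f ≠ 0) : (pderiv i f).totalDegree < f.totalDegree := by
  rw [Nat.lt_iff_add_one_le]
  obtain ⟨m, hm, hd⟩ := Finset.exists_mem_eq_sup _ (MvPolynomial.support_nonempty.2 h)
    (fun s : σ →₀ ℕ => s.sum fun _ e => e)
  have hc : coeff (m + Finsupp.single i 1) f ≠ 0 := by
    intro h0
    rw [mem_support_iff, coeff_pderiv, h0, zero_mul] at hm
    exact hm rfl
  have := le_totalDegree (mem_support_iff.2 hc)
  rw [Finsupp.sum_add_index' (by simp) (by simp)] at this
  simpa [totalDegree, hd] using this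

theorem MvPolynomial.eq_C_of_pderiv_eq_zero {σ R : Type*} [CommRing R] [IsDomain R] (p : ℕ)
    [CharP R p] (f : MvPolynomial σ R) (hf : f.totalDegree < p) (h : ∀ i, pderiv i f = 0) :
    f = C (coeff 0 f) := by
  classical
  ext m
  rw [coeff_C]
  split_ifs with hm
  · rw [hm]
  by_contra hc
  obtain ⟨i, hi⟩ : ∃ i, m i ≠ 0 := by
    by_contra! h0
    exact hm (Finsupp.ext h0).symm
  have h1 : m i ≤ f.totalDegree :=
    (Finsupp.le_degree i m).trans (le_totalDegree (mem_support_iff.2 hc))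
  have h2 := congrArg (coeff (m - Finsupp.single i 1)) (h i)
  have h3 : m - Finsupp.single i 1 + Finsupp.single i 1 = m :=
    tsub_add_cancel_of_le (by simpa [Finsupp.single_le_iff] using Nat.one_le_iff_ne_zero.2 hi)
  have h4 : (((m - (Finsupp.single i 1 : σ →₀ ℕ)) i : ℕ) : R) + 1 = (m i : ℕ) := by
    conv_rhs => rw [← h3]
    simp only [Finsupp.add_apply, Finsupp.single_eq_same, Nat.cast_add, Nat.cast_one]
  rw [coeff_pderiv, h3, h4, coeff_zero, mul_eq_zero] at h2
  rcases h2 with h2 | h2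
  · exact hc h2
  · rw [CharP.cast_eq_zero_iff R p] at h2
    exact absurd (Nat.le_of_dvd (Nat.pos_of_ne_zero hi) h2) (by omega)

theorem Polynomial.exists_eq_C_mul_of_derivative_mul_eq {K : Type*} [Field K] (p : ℕ) [CharP K p]
    {a b : Polynomial K} (ha : a ≠ 0) (hap : a.natDegree < p) (hbp : b.natDegree < p)
    (h : derivative b * a = derivative a * b) : ∃ c, b = C c * a := by
  have key : ∀ b : Polynomial K, b ≠ 0 → b.natDegree < p →
      derivative b * a = derivative a * b → b.natDegree = a.natDegree := by
    intro b hb hbp h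
    have top : ∀ r s : Polynomial K, (X * derivative r * s).coeff (r.natDegree + s.natDegree) =
        r.natDegree * r.leadingCoeff * s.leadingCoeff := by
      intro r s
      have h1 : (X * derivative r).coeff r.natDegree = r.natDegree * r.leadingCoeff := by
        rcases hr : r.natDegree with _ | k
        · simp
        · rw [coeff_X_mul, coeff_derivative, leadingCoeff, hr]; push_cast; ring
      have h2 : (X * derivative r).natDegree ≤ r.natDegree := by
        rw [natDegree_le_iff_coeff_eq_zero]
        intro N hN
        obtain ⟨k, rfl⟩ : ∃ k, N = k + 1 := ⟨N - 1, by omega⟩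
        rw [coeff_X_mul, coeff_derivative, coeff_eq_zero_of_natDegree_lt hN, zero_mul]
      rw [coeff_mul_add_eq_of_natDegree_le h2 le_rfl, h1, ← leadingCoeff]
    have e : X * derivative b * a = X * derivative a * b := by linear_combination X * h
    have e1 := top b a
    rw [e, add_comm, top a b] at e1
    have e2 : (a.natDegree : K) = b.natDegree := by
      have := mul_ne_zero (leadingCoeff_ne_zero.2 ha) (leadingCoeff_ne_zero.2 hb)
      apply mul_right_cancel₀ this
      linear_combination e1
    exact (CharP.natCast_injOn_Iio K p hap hbp e2).symm
  by_cases hb : b = 0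
  · exact ⟨0, by simp [hb]⟩
  refine ⟨b.leadingCoeff / a.leadingCoeff, ?_⟩
  have hd := key b hb hbp h
  have ha' := leadingCoeff_ne_zero.2 ha
  have hc : b.leadingCoeff / a.leadingCoeff ≠ 0 := div_ne_zero (leadingCoeff_ne_zero.2 hb) ha'
  by_contra hne
  have hlt : (b - C (b.leadingCoeff / a.leadingCoeff) * a).degree < b.degree := by
    refine degree_sub_lt_left ?_ hb ?_
    · rw [degree_C_mul hc, degree_eq_natDegree ha, degree_eq_natDegree hb, hd]
    · rw [leadingCoeff_mul, leadingCoeff_C, div_mul_cancel₀ _ ha']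
  have hnz := sub_ne_zero.2 hne
  have hlt' := natDegree_lt_natDegree hnz hlt
  have := key _ hnz (hlt'.trans hbp) (by
    simp only [derivative_sub, derivative_mul, derivative_C]
    linear_combination h)
  omega

/-- A symmetric bilinear form on a plane with three isotropic directions vanishes. -/
theorem bilin_eq_zero_of_three_isotropic {K V : Type*} [Field K] [AddCommGroup V] [Module K V]
    [FiniteDimensional K V] (h2 : (2 : K) ≠ 0) (B : V →ₗ[K] V →ₗ[K] K)
    (hB : ∀ u w, B u w = B w u) (W : Submodule K V) (hW : Module.finrank K W = 2)
    {v w₁ w₂ : V} (hv : v ∈ W) (hw₁ : w₁ ∈ W) (hw₂ : w₂ ∈ W)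
    (hvw₁ : LinearIndependent K ![v, w₁]) (hvw₂ : LinearIndependent K ![v, w₂])
    (hw : LinearIndependent K ![w₁, w₂])
    (hBv : B v v = 0) (hB₁ : B w₁ w₁ = 0) (hB₂ : B w₂ w₂ = 0) :
    ∀ u ∈ W, B v u = 0 := by
  have hspan : Submodule.span K {v, w₁} = W := by
    apply Submodule.eq_of_le_of_finrank_eq
    · rw [Submodule.span_le]
      rintro y (rfl | rfl) <;> assumption
    · have := finrank_span_eq_card hvw₁
      rw [hW]
      rwa [Matrix.range_cons_cons_empty, Fintype.card_fin] at this
  have hs : ∀ u ∈ W, ∃ a b : K, a • v + b • w₁ = u := fun u hu =>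
    Submodule.mem_span_pair.1 (hspan ▸ hu)
  obtain ⟨a, b, rfl⟩ := hs w₂ hw₂
  have ha : a ≠ 0 := by
    rintro rfl
    have := (LinearIndependent.pair_iff.1 hw) b (-1) (by simp)
    simp at this
  have hb : b ≠ 0 := by
    rintro rfl
    have := (LinearIndependent.pair_iff.1 hvw₂) a (-1) (by simp)
    simp at this
  have hvw : B v w₁ = 0 := by
    simp only [map_add, map_smul, LinearMap.add_apply, LinearMap.smul_apply, smul_eq_mul, hBv, hB₁,
      hB w₁ v] at hB₂
    have : 2 * a * b * B v w₁ = 0 := by linear_combination hB₂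
    simpa [h2, ha, hb] using this
  intro u hu
  obtain ⟨c, d, rfl⟩ := hs u hu
  simp [hBv, hvw]

theorem MvPolynomial.pderiv_comm {σ R : Type*} [CommRing R] (i j : σ) (f : MvPolynomial σ R) :
    pderiv i (pderiv j f) = pderiv j (pderiv i f) := by
  classical
  ext m
  simp only [coeff_pderiv, Finsupp.add_apply, add_right_comm m (Finsupp.single i 1)]
  by_cases h : i = j
  · rw [h]
  · simp [h, Ne.symm h]
    ring

theorem sum_mul_pderiv_eq_zero_of_line {σ R : Type*} [Fintype σ] [CommRing R] [IsDomain R]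
    [Fintype R] (f : MvPolynomial σ R) (hd : f.totalDegree < Fintype.card R) {y w : σ → R}
    (hw : ∀ t : R, MvPolynomial.eval (y + t • w) f = 0) :
    ∑ i, w i * MvPolynomial.eval y (MvPolynomial.pderiv i f) = 0 := by
  have h := congrArg (Polynomial.eval 0 ∘ Polynomial.derivative) (lineRestrict_eq_zero y w f hd hw)
  simpa [derivative_lineRestrict, Polynomial.eval_finsetSum, eval_lineRestrict] using h

/-- If `f` vanishes on three distinct lines through `y`, then the direction of `∇f` is
stationary at `y` along each of them. -/
theorem gradient_stationary_of_three_lines {K : Type*} [Field K] [Fintype K] (h2 : (2 : K) ≠ 0)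
    (f : MvPolynomial (Fin 3) K) (hd : f.totalDegree < Fintype.card K) {y v w₁ w₂ : Fin 3 → K}
    (hvw₁ : LinearIndependent K ![v, w₁]) (hvw₂ : LinearIndependent K ![v, w₂])
    (hw : LinearIndependent K ![w₁, w₂])
    (hv : ∀ t : K, MvPolynomial.eval (y + t • v) f = 0)
    (h₁ : ∀ t : K, MvPolynomial.eval (y + t • w₁) f = 0)
    (h₂ : ∀ t : K, MvPolynomial.eval (y + t • w₂) f = 0) (i j : Fin 3) :
    (∑ k, v k * MvPolynomial.eval y (MvPolynomial.pderiv k (MvPolynomial.pderiv i f))) *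
        MvPolynomial.eval y (MvPolynomial.pderiv j f) =
      (∑ k, v k * MvPolynomial.eval y (MvPolynomial.pderiv k (MvPolynomial.pderiv j f))) *
        MvPolynomial.eval y (MvPolynomial.pderiv i f) := by
  set n : Fin 3 → K := fun i => MvPolynomial.eval y (MvPolynomial.pderiv i f) with hn
  set M : Matrix (Fin 3) (Fin 3) K :=
    fun k i => MvPolynomial.eval y (MvPolynomial.pderiv k (MvPolynomial.pderiv i f)) with hM
  set φ : Module.Dual K (Fin 3 → K) := Fintype.linearCombination K n with hφ
  have hfirst : ∀ w : Fin 3 → K, (∀ t : K, MvPolynomial.eval (y + t • w) f = 0) → φ w = 0 :=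
    fun w hw => by
      simpa [hφ, Fintype.linearCombination_apply, hn] using sum_mul_pderiv_eq_zero_of_line f hd hw
  have hsecond : ∀ w : Fin 3 → K, (∀ t : K, MvPolynomial.eval (y + t • w) f = 0) →
      Matrix.toBilin' M w w = 0 := by
    intro w hw
    have h := congrArg (fun g => Polynomial.eval 0 (Polynomial.derivative
      (Polynomial.derivative g))) (lineRestrict_eq_zero y w f hd hw)
    simp only [derivative_lineRestrict, Polynomial.derivative_sum, Polynomial.derivative_mul,
      Polynomial.derivative_C, Polynomial.eval_finsetSum] at h
    rw [Matrix.toBilin'_apply, Finset.sum_comm, ← Polynomial.eval_zero (x := (0 : K))]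
    simp only [Polynomial.derivative_zero] at h
    rw [← h]
    refine Finset.sum_congr rfl fun i _ => ?_
    simp only [Polynomial.eval_mul, Polynomial.eval_finsetSum, eval_lineRestrict, Finset.mul_sum,
      zero_mul, zero_add, Polynomial.eval_C, zero_smul, add_zero, hM]
    exact Finset.sum_congr rfl fun k _ => by ring
  by_cases hn0 : φ = 0
  · have hz : ∀ i, n i = 0 := fun i => by
      have := LinearMap.congr_fun hn0 (Pi.single i 1)
      simpa [hφ, Fintype.linearCombination_apply_single] using this
    have hi : MvPolynomial.eval y (MvPolynomial.pderiv i f) = 0 := hz i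
    have hj : MvPolynomial.eval y (MvPolynomial.pderiv j f) = 0 := hz j
    rw [hi, hj, mul_zero, mul_zero]
  have hrank : Module.finrank K (LinearMap.ker φ) = 2 := by
    have := Module.Dual.finrank_ker_add_one_of_ne_zero hn0
    rw [Module.finrank_fin_fun] at this
    omega
  have hsymm : ∀ u w, Matrix.toBilin' M u w = Matrix.toBilin' M w u := by
    intro u w
    rw [Matrix.toBilin'_apply, Matrix.toBilin'_apply, Finset.sum_comm]
    refine Finset.sum_congr rfl fun i _ => Finset.sum_congr rfl fun k _ => ?_
    simp only [hM, MvPolynomial.pderiv_comm i k]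
    ring
  have key := bilin_eq_zero_of_three_isotropic h2 (Matrix.toBilin' M) hsymm (LinearMap.ker φ) hrank
    (hfirst v hv) (hfirst w₁ h₁) (hfirst w₂ h₂) hvw₁ hvw₂ hw (hsecond v hv) (hsecond w₁ h₁)
    (hsecond w₂ h₂) (n j • Pi.single i 1 - n i • Pi.single j 1) (by
      simp [hφ, Fintype.linearCombination_apply_single, mul_comm])
  have hcol : ∀ i, Matrix.toBilin' M v (Pi.single i 1) = ∑ k, v k * M k i := by
    intro i
    simp [Matrix.toBilin'_apply, Pi.single_apply]
  rw [map_sub, map_smul, map_smul, hcol, hcol, smul_eq_mul, smul_eq_mul] at key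
  linear_combination key

theorem exists_gradient_direction {K : Type*} [Field K] (p : ℕ) [CharP K p]
    (f : MvPolynomial (Fin 3) K) (hd : f.totalDegree < p) (x v : Fin 3 → K) (A : Finset K)
    (hA : 2 * f.totalDegree < A.card)
    (hflat : ∀ t ∈ A, ∀ i j, (∑ k, v k * MvPolynomial.eval (x + t • v)
        (MvPolynomial.pderiv k (MvPolynomial.pderiv i f))) *
        MvPolynomial.eval (x + t • v) (MvPolynomial.pderiv j f) =
      (∑ k, v k * MvPolynomial.eval (x + t • v)
        (MvPolynomial.pderiv k (MvPolynomial.pderiv j f))) *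
        MvPolynomial.eval (x + t • v) (MvPolynomial.pderiv i f))
    (hne : ∃ j, lineRestrict x v (MvPolynomial.pderiv j f) ≠ 0) :
    ∃ (c : Fin 3 → K) (g : Polynomial K), c ≠ 0 ∧ g ≠ 0 ∧ g.natDegree ≤ f.totalDegree ∧
      ∀ i, lineRestrict x v (MvPolynomial.pderiv i f) = Polynomial.C (c i) * g := by
  obtain ⟨j, hj⟩ := hne
  have hdeg : ∀ i, (lineRestrict x v (MvPolynomial.pderiv i f)).natDegree ≤ f.totalDegree := by
    intro i
    by_cases h : MvPolynomial.pderiv i f = 0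
    · simp [h]
    · exact (natDegree_lineRestrict_le ..).trans (MvPolynomial.totalDegree_pderiv_lt f i h).le
  have hw : ∀ i, (lineRestrict x v (MvPolynomial.pderiv i f)).derivative *
        lineRestrict x v (MvPolynomial.pderiv j f) =
      (lineRestrict x v (MvPolynomial.pderiv j f)).derivative *
        lineRestrict x v (MvPolynomial.pderiv i f) := by
    intro i
    have hder : ∀ i, (lineRestrict x v (MvPolynomial.pderiv i f)).derivative.natDegree ≤
        f.totalDegree := fun i =>
      (Polynomial.natDegree_derivative_le _).trans ((Nat.sub_le _ _).trans (hdeg i))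
    rw [← sub_eq_zero]
    refine Polynomial.eq_zero_of_natDegree_lt_card_of_eval_eq_zero' _ A ?_ (lt_of_le_of_lt ?_ hA)
    · intro t ht
      have := hflat t ht i j
      simp only [derivative_lineRestrict, Polynomial.eval_sub, Polynomial.eval_mul,
        Polynomial.eval_finsetSum, eval_lineRestrict, Polynomial.eval_C]
      rw [this, sub_self]
    · rw [two_mul]
      exact (Polynomial.natDegree_sub_le_of_le
        (Polynomial.natDegree_mul_le_of_le (hder i) (hdeg j))
        (Polynomial.natDegree_mul_le_of_le (hder j) (hdeg i))).trans (max_self _).le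
  choose c hc using fun i => Polynomial.exists_eq_C_mul_of_derivative_mul_eq p hj
    ((hdeg j).trans_lt hd) ((hdeg i).trans_lt hd) (hw i)
  refine ⟨c, _, ?_, hj, hdeg j, hc⟩
  rintro rfl
  exact hj (by simpa using hc j)

theorem exists_vanishing_polynomial {σ K : Type*} [Fintype σ] [Field K] (P : Finset (σ → K))
    (m : ℕ) (hP : P.card < (m + 1) ^ Fintype.card σ) :
    ∃ f : MvPolynomial σ K, f ≠ 0 ∧ f.totalDegree ≤ Fintype.card σ * m ∧
      ∀ y ∈ P, MvPolynomial.eval y f = 0 := by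
  classical
  set E := σ → Fin (m + 1)
  let s : E → (σ →₀ ℕ) := fun e => Finsupp.equivFunOnFinite.symm fun i => (e i : ℕ)
  have hs : Function.Injective s := fun e e' h => by
    ext i
    exact DFunLike.congr_fun h i
  let F : (E → K) →ₗ[K] MvPolynomial σ K :=
    Fintype.linearCombination K fun e => MvPolynomial.monomial (s e) 1
  let ev : (E → K) →ₗ[K] (P → K) :=
    LinearMap.pi fun y => (MvPolynomial.aeval (R := K) (y : σ → K)).toLinearMap ∘ₗ F
  have hker : LinearMap.ker ev ≠ ⊥ := by
    apply LinearMap.ker_ne_bot_of_finrank_lt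
    simpa [E] using hP
  obtain ⟨a, ha, ha0⟩ := Submodule.exists_mem_ne_zero_of_ne_bot hker
  refine ⟨F a, ?_, ?_, ?_⟩
  · intro h
    apply ha0
    ext e
    have := congrArg (MvPolynomial.coeff (s e)) h
    simp only [F, Fintype.linearCombination_apply, MvPolynomial.coeff_sum, MvPolynomial.coeff_smul,
      MvPolynomial.coeff_monomial, hs.eq_iff, smul_eq_mul, mul_ite, mul_one, mul_zero,
      MvPolynomial.coeff_zero] at this
    rwa [Finset.sum_ite_eq', if_pos (Finset.mem_univ _)] at this
  · rw [show F a = ∑ e, a e • MvPolynomial.monomial (s e) 1 from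
      Fintype.linearCombination_apply ..]
    refine MvPolynomial.totalDegree_finsetSum_le fun e _ => ?_
    refine (MvPolynomial.totalDegree_smul_le _ _).trans
      ((MvPolynomial.totalDegree_monomial_le _ _).trans ?_)
    rw [Finsupp.sum_fintype _ _ (fun _ => rfl)]
    refine (Finset.sum_le_card_nsmul _ _ m fun i _ => ?_).trans (by simp)
    exact Nat.lt_succ_iff.1 (e i).2
  · intro y hy
    have := congrFun (LinearMap.mem_ker.1 ha) ⟨y, hy⟩
    simpa [ev, MvPolynomial.aeval_eq_eval] using this

open scoped Classical in
/-- Any family of sets with total size exceeding `R |P|` has a nonempty subfamily each of whose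
members has few points of multiplicity at most `R`. -/
theorem exists_subfamily_few_poor_points {α : Type*} (P : Finset α) (L : Finset (Set α))
    (R k : ℕ) (h : R * P.card < k * L.card) :
    ∃ S ⊆ L, S.Nonempty ∧ ∀ l ∈ S,
      (P.filter fun y => y ∈ l ∧ (S.filter fun l' => y ∈ l').card ≤ R).card ≤ k := by
  let μ : Finset (Set α) → α → ℕ := fun S y => (S.filter fun l' => y ∈ l').card
  let Ψ : Finset (Set α) → ℤ := fun S => (∑ y ∈ P, min (μ S y) R : ℕ) - k * S.card
  obtain ⟨S, hSL, hmin⟩ := L.powerset.exists_min_image Ψ ⟨L, by simp⟩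
  rw [Finset.mem_powerset] at hSL
  refine ⟨S, hSL, ?_, ?_⟩
  · rw [Finset.nonempty_iff_ne_empty]
    rintro rfl
    have h1 := hmin L (by simp)
    have h2 : ∑ y ∈ P, min (μ L y) R ≤ P.card * R := by
      simpa using Finset.sum_le_card_nsmul P _ R fun y _ => min_le_right (μ L y) R
    simp only [Ψ, μ, Finset.filter_empty, Finset.card_empty, zero_min, Finset.sum_const_zero] at h1
    push_cast at h1
    zify at h h2
    simp only [μ] at h2
    linarith
  · intro l hl
    have h1 := hmin (S.erase l) (by simpa using (Finset.erase_subset _ _).trans hSL)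
    have h2 : ∀ y ∈ P, min (μ (S.erase l) y) R +
        (if y ∈ l ∧ μ S y ≤ R then 1 else 0) ≤ min (μ S y) R := by
      intro y _
      by_cases hy : y ∈ l
      · have h3 : μ (S.erase l) y + 1 = μ S y := by
          simp only [μ, Finset.filter_erase]
          exact Finset.card_erase_add_one (by simp [hl, hy])
        split_ifs <;> grind
      · have h3 : μ (S.erase l) y ≤ μ S y :=
          Finset.card_le_card (Finset.filter_subset_filter _ (Finset.erase_subset _ _))
        simp only [hy, false_and, if_false, add_zero]
        exact min_le_min_right _ h3
    have h4 := Finset.sum_le_sum h2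
    rw [Finset.sum_add_distrib, ← Finset.card_filter] at h4
    have h5 := Finset.card_erase_add_one hl
    simp only [Ψ] at h1
    rw [← h5] at h1
    push_cast at h1
    zify at h4 ⊢
    simp only [μ] at h1 h4
    linarith

theorem IsSpaceLine.exists_direction {F : Type*} [CommRing F] {l : Set (Fin 3 → F)}
    (hl : IsSpaceLine F l) {y : Fin 3 → F} (hy : y ∈ l) :
    ∃ v : Fin 3 → F, v ≠ 0 ∧ l = {z | ∃ t : F, z = y + t • v} := by
  obtain ⟨x, v, hv, rfl⟩ := hl
  obtain ⟨s, rfl⟩ := hy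
  refine ⟨v, hv, Set.ext fun z => ⟨?_, ?_⟩⟩
  · rintro ⟨t, rfl⟩
    exact ⟨t - s, by module⟩
  · rintro ⟨t, rfl⟩
    exact ⟨s + t, by module⟩

theorem linearIndependent_of_lines_ne {K V : Type*} [Field K] [AddCommGroup V] [Module K V]
    {y v w : V} (hv : v ≠ 0) (hw : w ≠ 0)
    (hne : {z | ∃ t : K, z = y + t • v} ≠ {z | ∃ t : K, z = y + t • w}) :
    LinearIndependent K ![v, w] := by
  rw [LinearIndependent.pair_iff' hv]
  rintro a rfl
  have ha : a ≠ 0 := by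
    rintro rfl
    simp at hw
  refine hne (Set.ext fun z => ⟨?_, ?_⟩)
  · rintro ⟨t, rfl⟩
    exact ⟨t / a, by rw [smul_smul, div_mul_cancel₀ _ ha]⟩
  · rintro ⟨t, rfl⟩
    exact ⟨t * a, by rw [smul_smul]⟩

theorem eq_of_two_points_mem {K V : Type*} [Field K] [AddCommGroup V] [Module K V]
    {y z v w : V} (hz : z ≠ y)
    (hv : ∃ t : K, z = y + t • v) (hw : ∃ t : K, z = y + t • w) :
    {z | ∃ t : K, z = y + t • v} = {z | ∃ t : K, z = y + t • w} := by
  obtain ⟨a, rfl⟩ := hv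
  obtain ⟨b, hb⟩ := hw
  have hab : a • v = b • w := add_left_cancel hb
  have ha : a ≠ 0 := by rintro rfl; simp at hz
  have hb0 : b ≠ 0 := by rintro rfl; simp [hab] at hz
  ext u
  constructor
  · rintro ⟨t, rfl⟩
    refine ⟨t / a * b, ?_⟩
    rw [mul_smul, ← hab, smul_smul, div_mul_cancel₀ _ ha]
  · rintro ⟨t, rfl⟩
    refine ⟨t / b * a, ?_⟩
    rw [mul_smul, hab, smul_smul, div_mul_cancel₀ _ hb0]

open scoped Classical in
/-- A family of lines with few points of multiplicity at most `R` on each line, all contained in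
the zero set of a polynomial of low degree, has many members in a common plane. -/
theorem exists_plane_with_many_lines {q : ℕ} [Fact q.Prime] (hq : q ≠ 2)
    (P : Finset (Fin 3 → ZMod q)) (S : Finset (Set (Fin 3 → ZMod q))) (hS : S.Nonempty)
    (hline : ∀ l ∈ S, IsSpaceLine (ZMod q) l) (hSP : ∀ l ∈ S, l ⊆ (P : Set (Fin 3 → ZMod q)))
    (R k d : ℕ) (hR : 2 ≤ R)
    (hpoor : ∀ l ∈ S,
      (P.filter fun y => y ∈ l ∧ (S.filter fun l' => y ∈ l').card ≤ R).card ≤ k)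
    (hf : ∃ f : MvPolynomial (Fin 3) (ZMod q), f ≠ 0 ∧ f.totalDegree ≤ d ∧
      ∀ y ∈ P, MvPolynomial.eval y f = 0)
    (hd : k + 2 * d < q) :
    ∃ π, IsAffinePlane (ZMod q) π ∧ (q - k - d) * R ≤ (S.filter fun l => l ⊆ π).card := by
  have h2 : (2 : ZMod q) ≠ 0 := by
    intro h
    have : (q : ℕ) ∣ 2 := (ZMod.natCast_eq_zero_iff 2 q).1 (by exact_mod_cast h)
    exact hq ((Nat.prime_dvd_prime_iff_eq Fact.out Nat.prime_two).1 this)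
  obtain ⟨f, ⟨hf0, hfS⟩, hmin⟩ := WellFounded.has_min
    (InvImage.wf (MvPolynomial.totalDegree (R := ZMod q) (σ := Fin 3)) Nat.lt_wfRel.wf)
    {f | f ≠ 0 ∧ ∀ l ∈ S, ∀ y ∈ l, MvPolynomial.eval y f = 0} (by
      obtain ⟨f, hf0, -, hfP⟩ := hf
      exact ⟨f, hf0, fun l hl y hy => hfP y (hSP l hl hy)⟩)
  have hfd : f.totalDegree ≤ d := by
    obtain ⟨f', hf0', hfd', hfP'⟩ := hf
    exact (not_lt.1 (hmin f' ⟨hf0', fun l hl y hy => hfP' y (hSP l hl hy)⟩)).trans hfd'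
  have hfq : f.totalDegree < q := by omega
  have hfq' : f.totalDegree < Fintype.card (ZMod q) := by rwa [ZMod.card]
  obtain ⟨i, hi⟩ : ∃ i, MvPolynomial.pderiv i f ≠ 0 := by
    by_contra! h
    have hC := MvPolynomial.eq_C_of_pderiv_eq_zero q f hfq h
    obtain ⟨l, hl⟩ := hS
    obtain ⟨x, v, -, rfl⟩ := hline l hl
    have := hfS _ hl x ⟨0, by simp⟩
    rw [hC, MvPolynomial.eval_C] at this
    rw [this, MvPolynomial.C_0] at hC
    exact hf0 hC
  obtain ⟨l, hl, y, hy, hyi⟩ : ∃ l ∈ S, ∃ y ∈ l,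
      MvPolynomial.eval y (MvPolynomial.pderiv i f) ≠ 0 := by
    by_contra! h
    exact hmin _ ⟨hi, h⟩ (MvPolynomial.totalDegree_pderiv_lt f i hi)
  obtain ⟨v, hv, hlv⟩ := (hline l hl).exists_direction hy
  have hlt : ∀ t : ZMod q, l = {z | ∃ s : ZMod q, z = y + t • v + s • v} := by
    intro t
    rw [hlv]
    ext z
    constructor
    · rintro ⟨s, rfl⟩
      exact ⟨s - t, by module⟩
    · rintro ⟨s, rfl⟩
      exact ⟨t + s, by module⟩
  have hmem : ∀ t : ZMod q, y + t • v ∈ l := fun t => hlv ▸ ⟨t, rfl⟩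
  have hinj : Function.Injective fun t : ZMod q => y + t • v := fun s t h =>
    smul_left_injective _ hv (add_left_cancel h)
  set A : Finset (ZMod q) :=
    Finset.univ.filter fun t => R < (S.filter fun l' => y + t • v ∈ l').card with hA
  have hAcard : q ≤ A.card + k := by
    have h1 : (Finset.univ \ A).card ≤ k := by
      refine (Finset.card_le_card_of_injOn (fun t => y + t • v) ?_ hinj.injOn).trans (hpoor l hl)
      intro t ht
      simp only [hA, Finset.mem_coe, Finset.mem_sdiff, Finset.mem_filter, Finset.mem_univ,
        true_and, not_lt] at ht ⊢
      exact ⟨hSP l hl (hmem t), hmem t, ht⟩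
    have h3 := Finset.card_sdiff_add_card_eq_card (Finset.subset_univ A)
    rw [Finset.card_univ, ZMod.card] at h3
    omega
  have hothers : ∀ t ∈ A, R ≤ ((S.filter fun l' => y + t • v ∈ l').erase l).card := by
    intro t ht
    rw [Finset.card_erase_of_mem (by simp [hl, hmem])]
    have := (Finset.mem_filter.1 ht).2
    omega
  have hvanish : ∀ l' ∈ S, ∀ {z w : Fin 3 → ZMod q}, l' = {u | ∃ s : ZMod q, u = z + s • w} →
      ∀ s : ZMod q, MvPolynomial.eval (z + s • w) f = 0 :=
    fun l' hl' z w hz s => hfS l' hl' _ (hz ▸ ⟨s, rfl⟩)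
  obtain ⟨c, g, hc, hg, hgd, hgrad⟩ := exists_gradient_direction q f hfq y v A (by omega) (by
    intro t ht i j
    obtain ⟨l₁, h₁, l₂, h₂, h₁₂⟩ := Finset.one_lt_card.1 (lt_of_lt_of_le hR (hothers t ht))
    simp only [Finset.mem_erase, Finset.mem_filter] at h₁ h₂
    obtain ⟨w₁, hw₁, hl₁⟩ := (hline l₁ h₁.2.1).exists_direction h₁.2.2
    obtain ⟨w₂, hw₂, hl₂⟩ := (hline l₂ h₂.2.1).exists_direction h₂.2.2
    refine gradient_stationary_of_three_lines h2 f hfq'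
      (linearIndependent_of_lines_ne (y := y + t • v) hv hw₁ ?_)
      (linearIndependent_of_lines_ne (y := y + t • v) hv hw₂ ?_)
      (linearIndependent_of_lines_ne (y := y + t • v) hw₁ hw₂ ?_)
      (hvanish l hl (hlt t)) (hvanish l₁ h₁.2.1 hl₁) (hvanish l₂ h₂.2.1 hl₂) i j
    · rw [← hlt t, ← hl₁]; exact Ne.symm h₁.1
    · rw [← hlt t, ← hl₂]; exact Ne.symm h₂.1
    · rw [← hl₁, ← hl₂]; exact h₁₂) ⟨i, fun h => hyi (by
      simpa [eval_lineRestrict] using congrArg (Polynomial.eval 0) h)⟩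
  set B := A.filter fun t => g.eval t ≠ 0 with hB
  have hBcard : A.card ≤ B.card + d := by
    have h1 : A \ B ⊆ g.roots.toFinset := by
      intro t ht
      simp only [hB, Finset.mem_sdiff, Finset.mem_filter, not_and, not_not] at ht
      simpa [hg] using ht.2 ht.1
    have h2 := (Finset.card_le_card h1).trans
      ((Multiset.toFinset_card_le _).trans (Polynomial.card_roots' g))
    have h3 := Finset.card_sdiff_add_card_eq_card (show B ⊆ A from Finset.filter_subset _ _)
    omega
  set φ : Module.Dual (ZMod q) (Fin 3 → ZMod q) := Fintype.linearCombination (ZMod q) c with hφ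
  have hφ0 : φ ≠ 0 := by
    intro h
    apply hc
    ext i
    simpa [hφ, Fintype.linearCombination_apply_single] using
      LinearMap.congr_fun h (Pi.single i 1)
  have htangent : ∀ t ∈ B, ∀ l' ∈ S, ∀ w, l' = {z | ∃ s : ZMod q, z = y + t • v + s • w} →
      φ w = 0 := by
    intro t ht l' hl' w hw
    have h := sum_mul_pderiv_eq_zero_of_line f hfq' (hvanish l' hl' hw)
    simp only [← eval_lineRestrict, hgrad, Polynomial.eval_mul, Polynomial.eval_C, ← mul_assoc,
      ← Finset.sum_mul] at h
    simpa [hφ, Fintype.linearCombination_apply, (Finset.mem_filter.1 ht).2] using h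
  obtain ⟨t₀, ht₀⟩ : B.Nonempty := Finset.card_pos.1 (by omega)
  have hφv : φ v = 0 := htangent t₀ ht₀ l hl v (hlt t₀)
  refine ⟨{z | z - y ∈ LinearMap.ker φ}, ⟨LinearMap.ker φ, y, ?_, rfl⟩, ?_⟩
  · have := Module.Dual.finrank_ker_add_one_of_ne_zero hφ0
    rw [Module.finrank_fin_fun] at this
    omega
  calc (q - k - d) * R ≤ B.card * R := Nat.mul_le_mul_right _ (by omega)
    _ ≤ ∑ t ∈ B, ((S.filter fun l' => y + t • v ∈ l').erase l).card := by
      simpa using Finset.card_nsmul_le_sum B _ R fun t ht =>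
        hothers t (Finset.mem_filter.1 ht).1
    _ = (B.biUnion fun t => (S.filter fun l' => y + t • v ∈ l').erase l).card := by
      refine (Finset.card_biUnion fun s _ t _ hst => ?_).symm
      refine Finset.disjoint_left.2 ?_
      intro l' h₁ h₂
      simp only [Finset.mem_erase, Finset.mem_filter] at h₁ h₂
      obtain ⟨w, -, hw⟩ := (hline l' h₁.2.1).exists_direction h₁.2.2
      refine h₁.1 ?_
      rw [hlt s, hw]
      refine eq_of_two_points_mem (z := y + t • v) (fun h => hst (hinj h).symm) ?_ ?_
      · simpa [hw] using h₂.2.2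
      · exact ⟨t - s, by module⟩
    _ ≤ _ := by
      refine Finset.card_le_card fun l' hl' => ?_
      simp only [Finset.mem_biUnion, Finset.mem_erase, Finset.mem_filter] at hl' ⊢
      obtain ⟨t, ht, -, hl'S, htl'⟩ := hl'
      refine ⟨hl'S, ?_⟩
      obtain ⟨w, -, hw⟩ := (hline l' hl'S).exists_direction htl'
      have hφw := htangent t ht l' hl'S w hw
      rw [hw]
      rintro _ ⟨s, rfl⟩
      simp [add_assoc, hφv, hφw]

open scoped Classical in
theorem kakeya_wolff_axiom :
    ∀ C₀ : ℝ, 1 ≤ C₀ → ∀ c₁ : ℝ, 0 < c₁ → ∀ C₁ : ℝ, 1 ≤ C₁ →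
      ∃ ε : ℝ, 0 < ε ∧ ∃ c : ℝ, 0 < c ∧
        ∀ q : ℕ, q.Prime →
          ∀ L : Finset (Set (Fin 3 → ZMod q)),
            (∀ l ∈ L, IsSpaceLine (ZMod q) l) →
            (∀ π : Set (Fin 3 → ZMod q), IsAffinePlane (ZMod q) π →
              ((L.filter fun l => l ⊆ π).card : ℝ) ≤ C₀ * q) →
            c₁ * (q : ℝ) ^ 2 ≤ (L.card : ℝ) → (L.card : ℝ) ≤ C₁ * (q : ℝ) ^ 2 →
            ∀ P : Finset (Fin 3 → ZMod q), (∀ l ∈ L, l ⊆ (P : Set (Fin 3 → ZMod q))) →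
              c * (q : ℝ) ^ (5 / 2 + ε : ℝ) ≤ (P.card : ℝ) := by
  intro C₀ hC₀ c₁ hc₁ C₁ hC₁
  set R : ℕ := ⌈3 * C₀⌉₊ with hR
  have hRC : 3 * C₀ ≤ R := Nat.le_ceil _
  have hR3 : (3 : ℝ) ≤ R := by linarith
  refine ⟨1 / 2, by norm_num, min (c₁ / (3 * R)) (1 / 24 ^ 3), by positivity, ?_⟩
  intro q hq L hline hplane hL _ P hP
  have : Fact q.Prime := ⟨hq⟩
  rw [show (5 / 2 + 1 / 2 : ℝ) = (3 : ℕ) by norm_num, Real.rpow_natCast]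
  by_contra! hlt
  have hq2 : (2 : ℝ) ≤ q := by exact_mod_cast hq.two_le
  have hq0 : (0 : ℝ) < q := by linarith
  have hlt₁ : (P.card : ℝ) < c₁ / (3 * R) * q ^ 3 :=
    hlt.trans_le (mul_le_mul_of_nonneg_right (min_le_left _ _) (by positivity))
  have hlt₂ : (P.card : ℝ) < 1 / 24 ^ 3 * q ^ 3 :=
    hlt.trans_le (mul_le_mul_of_nonneg_right (min_le_right _ _) (by positivity))
  set m := q / 24 with hm
  have hPm : P.card < (m + 1) ^ Fintype.card (Fin 3) := by
    rw [Fintype.card_fin]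
    have h1 : (q : ℝ) < 24 * (m + 1) := by
      have : q < 24 * (m + 1) := by omega
      exact_mod_cast this
    have h2 : (q : ℝ) ^ 3 < (24 * (m + 1)) ^ 3 := pow_lt_pow_left₀ h1 hq0.le (by norm_num)
    have h3 : (P.card : ℝ) < (m + 1) ^ 3 := by
      rw [mul_pow] at h2
      linarith
    exact_mod_cast h3
  have hprune : R * P.card < q / 2 * L.card := by
    have h1 : (q : ℝ) ≤ 3 * (q / 2 : ℕ) := by
      have := hq.two_le
      have : q ≤ 3 * (q / 2) := by omega
      exact_mod_cast this
    have h2 : (R : ℝ) * P.card < c₁ * q ^ 3 / 3 := by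
      have := mul_lt_mul_of_pos_left hlt₁ (show (0 : ℝ) < R by linarith)
      have e : (R : ℝ) * (c₁ / (3 * R) * q ^ 3) = c₁ * q ^ 3 / 3 := by field_simp
      rwa [e] at this
    have h3 : (q : ℝ) * (c₁ * q ^ 2) ≤ 3 * (q / 2 : ℕ) * L.card :=
      mul_le_mul h1 hL (by positivity) (by positivity)
    have h4 : (R : ℝ) * P.card < (q / 2 : ℕ) * L.card := by linarith
    exact_mod_cast h4
  obtain ⟨S, hSL, hS, hpoor⟩ := exists_subfamily_few_poor_points P L R (q / 2) hprune
  have hq24 : 24 ≤ q := by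
    by_contra! h
    have hm0 : m = 0 := by omega
    obtain ⟨l, hl⟩ := hS
    obtain ⟨x, v, -, hx⟩ := hline l (hSL hl)
    have hxP : x ∈ P := hP l (hSL hl) (hx ▸ ⟨0, by simp⟩)
    have := Finset.card_pos.2 ⟨x, hxP⟩
    simp only [hm0, zero_add, one_pow] at hPm
    omega
  obtain ⟨π, hπ, hcard⟩ := exists_plane_with_many_lines (by omega) P S hS
    (fun l hl => hline l (hSL hl)) (fun l hl => hP l (hSL hl)) R (q / 2) (3 * m)
    (by have : 3 ≤ R := by exact_mod_cast hR3
        omega) hpoor (exists_vanishing_polynomial P m hPm) (by omega)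
  have h1 : ((S.filter fun l => l ⊆ π).card : ℝ) ≤ C₀ * q :=
    le_trans (by exact_mod_cast Finset.card_le_card (Finset.filter_subset_filter _ hSL))
      (hplane π hπ)
  have h2 : (((q - q / 2 - 3 * m : ℕ) : ℝ)) * R ≤ C₀ * q := le_trans (by exact_mod_cast hcard) h1
  have h3 : (3 : ℝ) * q ≤ 8 * (q - q / 2 - 3 * m : ℕ) := by
    have : 3 * q ≤ 8 * (q - q / 2 - 3 * m) := by omega
    exact_mod_cast this
  have h4 : 3 * (q : ℝ) * (3 * C₀) ≤ 8 * (q - q / 2 - 3 * m : ℕ) * R :=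
    mul_le_mul h3 hRC (by positivity) (by positivity)
  have h5 : 0 < C₀ * q := by positivity
  linarith
end

section
/- There exist absolute constants ε > 0 and c > 0 such that: for every prime q, with F = ℤ/qℤ, every Besicovitch set P ⊆ F³ — that is, a set such that for every v ∈ F³ \ {0} there exists x ∈ F³ with {x + t·v : t ∈ F} ⊆ P — satisfies |P| ≥ c·|F|^{5/2 + ε}. -/
namespace MvPolynomial

/-- A nonzero polynomial supported on `S` and vanishing on `P` exists once `P` is smaller
than `S`. -/
theorem exists_ne_zero_support_subset_eval_eq_zero {σ F : Type*} [Field F]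
    (S : Finset (σ →₀ ℕ)) (P : Finset (σ → F)) (h : P.card < S.card) :
    ∃ p : MvPolynomial σ F, p ≠ 0 ∧ p.support ⊆ S ∧ ∀ x ∈ P, eval x p = 0 := by
  let toPoly : (S → F) →ₗ[F] MvPolynomial σ F := ∑ d : S, (monomial d.1) ∘ₗ LinearMap.proj d
  let evalOn : MvPolynomial σ F →ₗ[F] (P → F) :=
    LinearMap.pi fun x => (aeval (R := F) x.1).toLinearMap
  have coeff_toPoly (a : S → F) (d : S) : coeff d.1 (toPoly a) = a d := by
    classical
    simp [toPoly, LinearMap.sum_apply, coeff_sum, coeff_monomial]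
  have hker : LinearMap.ker (evalOn ∘ₗ toPoly) ≠ ⊥ :=
    LinearMap.ker_ne_bot_of_finrank_lt (by simpa using h)
  obtain ⟨a, ha, ha0⟩ := (Submodule.ne_bot_iff _).1 hker
  refine ⟨toPoly a, fun h0 => ha0 ?_, ?_, fun x hx => ?_⟩
  · ext d
    simpa [h0] using (coeff_toPoly a d).symm
  · classical
    intro d hd
    by_contra hdS
    rw [mem_support_iff] at hd
    refine hd ?_
    simp only [toPoly, LinearMap.sum_apply, coeff_sum, LinearMap.comp_apply, coeff_monomial]
    exact Finset.sum_eq_zero fun e _ => if_neg fun he : e.1 = d => hdS (he ▸ e.2)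
  · have := congrFun (LinearMap.mem_ker.1 ha) ⟨x, hx⟩
    simpa [evalOn, coe_aeval_eq_eval] using this

/-- The restriction of `p` to the line through `x` in direction `v`, as a polynomial in the
parameter. -/
noncomputable def restrictLine {σ F : Type*} [CommRing F] (x v : σ → F) :
    MvPolynomial σ F →ₐ[F] Polynomial F :=
  aeval fun i => Polynomial.C (x i) + Polynomial.C (v i) * Polynomial.X

theorem eval_restrictLine {σ F : Type*} [CommRing F] (x v : σ → F) (p : MvPolynomial σ F)
    (t : F) : (restrictLine x v p).eval t = eval (x + t • v) p := by
  have : (Polynomial.aeval t).comp (restrictLine x v) = aeval (R := F) (x + t • v) := by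
    ext i
    simp only [restrictLine, AlgHom.comp_apply, aeval_X, map_add, map_mul, Polynomial.aeval_C,
      Polynomial.aeval_X, Algebra.algebraMap_self_apply, Pi.add_apply, Pi.smul_apply, smul_eq_mul]
    ring
  simpa [coe_aeval_eq_eval, Polynomial.aeval_def] using DFunLike.congr_fun this p

theorem natDegree_restrictLine_monomial_le_and_coeff {σ F : Type*} [CommRing F]
    (x v : σ → F) (d : σ →₀ ℕ) :
    (restrictLine x v (monomial d 1)).natDegree ≤ d.degree ∧
      (restrictLine x v (monomial d 1)).coeff d.degree = eval v (monomial d 1) := by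
  have linear_le (i : σ) :
      (Polynomial.C (x i) + Polynomial.C (v i) * Polynomial.X).natDegree ≤ 1 := by
    compute_degree
  induction d using Finsupp.induction_linear with
  | zero => simp
  | add d e hd he =>
    have hmul : (monomial (d + e) 1 : MvPolynomial σ F) = monomial d 1 * monomial e 1 := by
      simp [monomial_mul]
    rw [hmul, map_mul, map_mul, map_add]
    refine ⟨Polynomial.natDegree_mul_le_of_le hd.1 he.1, ?_⟩
    rw [Polynomial.coeff_mul_add_eq_of_natDegree_le hd.1 he.1, hd.2, he.2]
  | single i n =>
    have hmon : restrictLine x v (monomial (Finsupp.single i n) 1) =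
        (Polynomial.C (x i) + Polynomial.C (v i) * Polynomial.X) ^ n := by
      simp [restrictLine, aeval_monomial]
    rw [hmon, Finsupp.degree_single]
    refine ⟨by simpa using Polynomial.natDegree_pow_le_of_le n (linear_le i), ?_⟩
    have := Polynomial.coeff_pow_of_natDegree_le (m := n) (linear_le i)
    simpa [eval_monomial] using this

theorem natDegree_restrictLine_le {σ F : Type*} [CommRing F] (x v : σ → F)
    (p : MvPolynomial σ F) : (restrictLine x v p).natDegree ≤ p.totalDegree := by
  conv_lhs => rw [p.as_sum, map_sum]
  refine Polynomial.natDegree_sum_le_of_forall_le _ _ fun d hd => ?_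
  rw [← mul_one (coeff d p), ← smul_eq_mul, ← smul_monomial, map_smul]
  exact (Polynomial.natDegree_smul_le _ _).trans
    ((natDegree_restrictLine_monomial_le_and_coeff x v d).1.trans (le_totalDegree hd))

theorem coeff_restrictLine_totalDegree {σ F : Type*} [CommRing F] (x v : σ → F)
    (p : MvPolynomial σ F) :
    (restrictLine x v p).coeff p.totalDegree =
      eval v (homogeneousComponent p.totalDegree p) := by
  conv_lhs => rw [p.as_sum, map_sum, ← p.as_sum]
  rw [homogeneousComponent_apply, map_sum, Finset.sum_filter, Polynomial.finsetSum_coeff]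
  refine Finset.sum_congr rfl fun d hd => ?_
  obtain ⟨hdeg, hcoeff⟩ := natDegree_restrictLine_monomial_le_and_coeff x v d
  rw [← mul_one (coeff d p), ← smul_eq_mul, ← smul_monomial, map_smul, Polynomial.coeff_smul]
  split_ifs with h
  · rw [← h, hcoeff, smul_eval, smul_eq_mul]
  · have hle : d.degree ≤ p.totalDegree := le_totalDegree hd
    rw [Polynomial.coeff_eq_zero_of_natDegree_lt (by omega), smul_zero]

theorem homogeneousComponent_totalDegree_ne_zero {σ R : Type*} [CommSemiring R]
    {p : MvPolynomial σ R} (hp : p ≠ 0) : homogeneousComponent p.totalDegree p ≠ 0 := by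
  obtain ⟨d, hd, hdeg⟩ := Finset.exists_mem_eq_sup p.support (support_nonempty.2 hp)
    fun d => d.sum fun _ e => e
  intro h0
  have hcoeff := coeff_homogeneousComponent p.totalDegree p d
  have hd_degree : d.degree = p.totalDegree := hdeg.symm
  rw [h0, coeff_zero, if_pos hd_degree] at hcoeff
  exact mem_support_iff.1 hd hcoeff.symm

/-- A polynomial of degree less than `|F|` vanishing on a line in every direction is zero. -/
theorem eq_zero_of_eval_line_eq_zero {σ F : Type*} [Field F] [Fintype F] [Nonempty σ]
    (p : MvPolynomial σ F) (hdeg : p.totalDegree < Fintype.card F)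
    (hp : ∀ v : σ → F, v ≠ 0 → ∃ x : σ → F, ∀ t : F, eval (x + t • v) p = 0) : p = 0 := by
  have exists_line (v : σ → F) : ∃ x : σ → F, ∀ t : F, eval (x + t • v) p = 0 := by
    rcases ne_or_eq v 0 with hv | rfl
    · exact hp v hv
    · obtain ⟨x, hx⟩ := hp 1 one_ne_zero
      exact ⟨x, fun t => by simpa using hx 0⟩
  have eval_leading (v : σ → F) : eval v (homogeneousComponent p.totalDegree p) = 0 := by
    obtain ⟨x, hx⟩ := exists_line v
    have hzero : restrictLine x v p = 0 :=
      Polynomial.eq_zero_of_natDegree_lt_card_of_eval_eq_zero _ Function.injective_id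
        (fun t => by rw [id, eval_restrictLine, hx])
        ((natDegree_restrictLine_le x v p).trans_lt hdeg)
    rw [← coeff_restrictLine_totalDegree x, hzero, Polynomial.coeff_zero]
  by_contra hp0
  refine homogeneousComponent_totalDegree_ne_zero hp0 <|
    (homogeneousComponent_isHomogeneous _ p).eq_zero_of_forall_eval_eq_zero_of_le_card
      eval_leading ?_
  rw [Cardinal.mk_fintype]
  exact_mod_cast hdeg.le

end MvPolynomial

/-- Dvir's bound for Besicovitch sets over a finite field, with a box of monomials of side `m`
in place of the full simplex. -/
theorem pow_card_le_card_of_line_subset {σ F : Type*} [Field F] [Fintype F] [Fintype σ]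
    [Nonempty σ] (P : Finset (σ → F))
    (hP : ∀ v : σ → F, v ≠ 0 → ∃ x : σ → F, ∀ t : F, x + t • v ∈ P)
    (m : ℕ) (hm : Fintype.card σ * m < Fintype.card F) :
    (m + 1) ^ Fintype.card σ ≤ P.card := by
  classical
  by_contra! hlt
  let S : Finset (σ →₀ ℕ) :=
    (Fintype.piFinset fun _ : σ => Finset.range (m + 1)).map
      Finsupp.equivFunOnFinite.symm.toEmbedding
  have hS : S.card = (m + 1) ^ Fintype.card σ := by simp [S]
  obtain ⟨p, hp0, hpS, hpP⟩ :=
    MvPolynomial.exists_ne_zero_support_subset_eval_eq_zero S P (hS ▸ hlt)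
  refine hp0 (MvPolynomial.eq_zero_of_eval_line_eq_zero p (lt_of_le_of_lt ?_ hm) fun v hv => ?_)
  · refine Finset.sup_le fun d hd => ?_
    obtain ⟨f, hf, rfl⟩ := Finset.mem_map.1 (hpS hd)
    rw [Fintype.mem_piFinset] at hf
    rw [Finsupp.sum_fintype _ _ fun _ => rfl]
    refine (Finset.sum_le_card_nsmul Finset.univ _ m fun i _ => ?_).trans (by simp)
    exact Nat.lt_succ_iff.1 (Finset.mem_range.1 (hf i))
  · obtain ⟨x, hx⟩ := hP v hv
    exact ⟨x, fun t => hpP _ (hx t)⟩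

theorem besicovitch_set_bound :
    ∃ ε : ℝ, 0 < ε ∧ ∃ c : ℝ, 0 < c ∧
      ∀ q : ℕ, q.Prime →
        ∀ P : Finset (Fin 3 → ZMod q),
          (∀ v : Fin 3 → ZMod q, v ≠ 0 → ∃ x : Fin 3 → ZMod q,
            ∀ t : ZMod q, x + t • v ∈ P) →
          c * (q : ℝ) ^ (5 / 2 + ε : ℝ) ≤ (P.card : ℝ) := by
  refine ⟨1 / 2, by norm_num, 1 / 27, by norm_num, fun q hq P hP => ?_⟩
  have : Fact q.Prime := ⟨hq⟩
  have hpos := hq.pos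
  have key := pow_card_le_card_of_line_subset P hP ((q - 1) / 3) (by
    rw [Fintype.card_fin, ZMod.card]
    omega)
  rw [Fintype.card_fin] at key
  have hq3 : q ≤ 3 * ((q - 1) / 3 + 1) := by omega
  have hcard : q ^ 3 ≤ 27 * P.card :=
    calc q ^ 3 ≤ (3 * ((q - 1) / 3 + 1)) ^ 3 := Nat.pow_le_pow_left hq3 3
      _ = 27 * ((q - 1) / 3 + 1) ^ 3 := by ring
      _ ≤ 27 * P.card := Nat.mul_le_mul_left 27 key
  have hexp : (5 / 2 + 1 / 2 : ℝ) = (3 : ℕ) := by norm_num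
  rw [hexp, Real.rpow_natCast]
  have : (q : ℝ) ^ 3 ≤ 27 * P.card := by exact_mod_cast hcard
  linarith
end

section
/- There exist absolute constants C ≥ 1 and c > 0 such that: for every additive abelian group Z, all finite subsets A, B ⊆ Z with |A| = |B|, every real K ≥ 1, and every subset G ⊆ A × B with |G| ≥ |A|·|B|/K and |{a + b : (a,b) ∈ G}| ≤ K·|A|, there exist subsets A' ⊆ A and B' ⊆ B with |A'| ≥ c·K^{-C}·|A| and |B'| ≥ c·K^{-C}·|B| such that |A' − B'| ≤ C·K^C·|A|, where A' − B' := {a − b : a ∈ A', b ∈ B'}. -/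
open Pointwise

open Finset in
/-- Dependent random choice: in a dense bipartite graph some vertex has a large neighborhood in which
few pairs have few common neighbors. -/
lemma exists_neighborhood_few_bad_pairs {α β : Type*} (A : Finset α) (B : Finset β)
    (r : α → β → Prop) [∀ a b, Decidable (r a b)] (hB : B.Nonempty) {ε d : ℝ} (hε : 0 < ε)
    (hd : 0 ≤ d) (h : d * #A * #B ≤ ∑ b ∈ B, (#{a ∈ A | r a b} : ℝ)) :
    ∃ b ∈ B, d ^ 2 * #A ^ 2 / 2 ≤ (#{a ∈ A | r a b} : ℝ) ^ 2 ∧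
      (#{p ∈ {a ∈ A | r a b} ×ˢ {a ∈ A | r a b} |
        (#{b' ∈ B | r p.1 b' ∧ r p.2 b'} : ℝ) < ε * d ^ 2 * #B / 2} : ℝ) ≤
        ε * (#{a ∈ A | r a b} : ℝ) ^ 2 := by
  have hB0 : (0 : ℝ) < #B := by exact_mod_cast hB.card_pos
  set bad : Finset (α × α) :=
    {p ∈ A ×ˢ A | (#{b' ∈ B | r p.1 b' ∧ r p.2 b'} : ℝ) < ε * d ^ 2 * #B / 2} with hbad
  have hsq : d ^ 2 * #A ^ 2 * #B ≤ ∑ b ∈ B, (#{a ∈ A | r a b} : ℝ) ^ 2 := by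
    have h1 := sq_sum_le_card_mul_sum_sq (s := B) (f := fun b => (#{a ∈ A | r a b} : ℝ))
    have h2 := pow_le_pow_left₀ (by positivity) h 2
    refine le_of_mul_le_mul_left ?_ hB0
    linarith
  have hcount : ∑ b ∈ B, (#{p ∈ bad | r p.1 b ∧ r p.2 b} : ℝ) ≤ #A ^ 2 * (ε * d ^ 2 * #B / 2) := by
    have h1 := sum_card_bipartiteAbove_eq_sum_card_bipartiteBelow (s := bad) (t := B)
      (fun p b => r p.1 b ∧ r p.2 b)
    simp only [bipartiteAbove, bipartiteBelow] at h1
    have h2 : ∑ b ∈ B, (#{p ∈ bad | r p.1 b ∧ r p.2 b} : ℝ) =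
        ∑ p ∈ bad, (#{b ∈ B | r p.1 b ∧ r p.2 b} : ℝ) := by exact_mod_cast h1.symm
    rw [h2]
    calc _ ≤ ∑ p ∈ bad, (ε * d ^ 2 * #B / 2) :=
          sum_le_sum fun p hp => (mem_filter.1 hp).2.le
      _ = #bad * (ε * d ^ 2 * #B / 2) := by rw [sum_const, nsmul_eq_mul]
      _ ≤ _ := by
          gcongr
          have : #bad ≤ #(A ×ˢ A) := card_filter_le _ _
          rw [card_product] at this
          rw [sq]
          exact_mod_cast this
  have hsum : ∑ _b ∈ B, (d ^ 2 * #A ^ 2 / 2 : ℝ) ≤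
      ∑ b ∈ B, ((#{a ∈ A | r a b} : ℝ) ^ 2 - (#{p ∈ bad | r p.1 b ∧ r p.2 b} : ℝ) / ε) := by
    rw [sum_sub_distrib, sum_const, nsmul_eq_mul, ← sum_div]
    have : (∑ b ∈ B, (#{p ∈ bad | r p.1 b ∧ r p.2 b} : ℝ)) / ε ≤ #A ^ 2 * (d ^ 2 * #B / 2) := by
      rw [div_le_iff₀ hε]
      linarith
    refine le_trans (le_of_eq ?_) (sub_le_sub hsq this)
    ring
  obtain ⟨b, hb, hle⟩ := exists_le_of_sum_le hB hsum
  have heq : {p ∈ {a ∈ A | r a b} ×ˢ {a ∈ A | r a b} |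
        (#{b' ∈ B | r p.1 b' ∧ r p.2 b'} : ℝ) < ε * d ^ 2 * #B / 2} =
      {p ∈ bad | r p.1 b ∧ r p.2 b} := by
    ext p
    simp only [hbad, mem_filter, mem_product]
    tauto
  refine ⟨b, hb, ?_, ?_⟩
  · have : (0 : ℝ) ≤ (#{p ∈ bad | r p.1 b ∧ r p.2 b} : ℝ) / ε := by positivity
    linarith
  · rw [heq]
    have : (0 : ℝ) ≤ d ^ 2 * #A ^ 2 / 2 := by positivity
    rw [mul_comm, ← div_le_iff₀ hε]
    linarith

open Finset in
/-- Discarding the terms below `t` lowers a sum over `s` by at most `#s * t`. -/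
lemma sum_sub_card_mul_le_sum_filter {ι : Type*} (s : Finset ι) (f : ι → ℝ) {t : ℝ} (ht : 0 ≤ t) :
    ∑ i ∈ s, f i - #s * t ≤ ∑ i ∈ s with t ≤ f i, f i := by
  rw [← sum_filter_add_sum_filter_not s (fun i => t ≤ f i)]
  have : ∑ i ∈ s with ¬ t ≤ f i, f i ≤ #s * t := by
    calc _ ≤ #{i ∈ s | ¬ t ≤ f i} * t := by
          rw [← nsmul_eq_mul]
          exact sum_le_card_nsmul _ _ _ fun i hi => (not_le.1 (mem_filter.1 hi).2).le
      _ ≤ _ := by gcongr; exact filter_subset _ _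
  linarith

open Finset in
/-- A dense bipartite graph has large vertex subsets all of whose pairs are joined by many paths of
length three. -/
lemma exists_subsets_many_paths {α β : Type*} (A : Finset α) (B : Finset β)
    (r : α → β → Prop) [∀ a b, Decidable (r a b)] (hA : A.Nonempty) (hB : B.Nonempty) {δ : ℝ}
    (hδ : 0 < δ) (h : δ * #A * #B ≤ ∑ a ∈ A, (#{b ∈ B | r a b} : ℝ)) :
    ∃ A' ⊆ A, ∃ B' ⊆ B, δ * #A / 6 ≤ #A' ∧ δ * #B / 4 ≤ #B' ∧
      ∀ a ∈ A', ∀ b ∈ B', δ ^ 5 * #A * #B / 3072 ≤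
        (#{p ∈ A ×ˢ B | r a p.2 ∧ r p.1 p.2 ∧ r p.1 b} : ℝ) := by
  classical
  have hA0 : (0 : ℝ) < #A := by exact_mod_cast hA.card_pos
  have hB0 : (0 : ℝ) < #B := by exact_mod_cast hB.card_pos
  set A₁ : Finset α := {a ∈ A | δ / 2 * #B ≤ (#{b ∈ B | r a b} : ℝ)}
  have double_count (S : Finset α) : ∑ a ∈ S, (#{b ∈ B | r a b} : ℝ) =
      ∑ b ∈ B, (#{a ∈ S | r a b} : ℝ) := by
    exact_mod_cast sum_card_bipartiteAbove_eq_sum_card_bipartiteBelow (s := S) (t := B) r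
  have hedges : δ / 2 * #A * #B ≤ ∑ a ∈ A₁, (#{b ∈ B | r a b} : ℝ) := by
    have := sum_sub_card_mul_le_sum_filter A (fun a => (#{b ∈ B | r a b} : ℝ))
      (t := δ / 2 * #B) (by positivity)
    linarith
  have hA₁A : A₁ ⊆ A := filter_subset _ _
  have hA₁pos : (0 : ℝ) < #A₁ := by
    have : A₁.Nonempty := by
      by_contra hne
      rw [not_nonempty_iff_eq_empty.1 hne, sum_empty] at hedges
      have : 0 < δ / 2 * #A * #B := by positivity
      linarith
    exact_mod_cast this.card_pos
  set d : ℝ := δ / 2 * #A / #A₁ with hd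
  have hdA : d * #A₁ = δ / 2 * #A := by rw [hd]; field_simp
  have hdδ : δ / 2 ≤ d := by
    rw [hd, le_div_iff₀ hA₁pos]
    gcongr
  obtain ⟨b₀, -, hN, hbad⟩ := exists_neighborhood_few_bad_pairs A₁ B r hB (ε := δ / 16) (d := d)
    (by positivity) (by positivity) (by rw [hdA, ← double_count]; exact hedges)
  set N : Finset α := {a ∈ A₁ | r a b₀} with hNdef
  have hNsq : (δ * #A / 3) ^ 2 ≤ (#N : ℝ) ^ 2 := by
    have : d ^ 2 * #A₁ ^ 2 = (δ / 2 * #A) ^ 2 := by rw [← hdA]; ring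
    rw [this] at hN
    nlinarith [sq_nonneg (δ * #A)]
  have hNcard : δ * #A / 3 ≤ (#N : ℝ) := 
    (pow_le_pow_iff_left₀ (by positivity) (by positivity) two_ne_zero).1 hNsq
  have hNpos : (0 : ℝ) < #N := lt_of_lt_of_le (by positivity) hNcard
  have hNA₁ : N ⊆ A₁ := filter_subset _ _
  set common : α → α → ℝ := fun a a' => #{b' ∈ B | r a b' ∧ r a' b'} with hcommon
  set τ : ℝ := δ ^ 3 * #B / 128 with hτ
  have hτle : τ ≤ δ / 16 * d ^ 2 * #B / 2 := by
    have : (δ / 2) ^ 2 ≤ d ^ 2 := by gcongr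
    calc τ = δ / 16 * (δ / 2) ^ 2 * #B / 2 := by rw [hτ]; ring
      _ ≤ _ := by gcongr
  have hbadsum : ∑ a ∈ N, (#{a' ∈ N | common a a' < τ} : ℝ) ≤ δ / 16 * #N ^ 2 := by
    refine le_trans ?_ hbad
    have h1 : ∑ a ∈ N, #{a' ∈ N | common a a' < τ} = #{p ∈ N ×ˢ N | common p.1 p.2 < τ} := by
      simp only [card_filter, sum_product]
    rw [← Nat.cast_sum, h1]
    gcongr
  refine ⟨{a ∈ N | (#{a' ∈ N | common a a' < τ} : ℝ) ≤ δ / 8 * #N},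
    (filter_subset _ _).trans (hNA₁.trans hA₁A), {b ∈ B | δ / 4 * #N ≤ (#{a ∈ N | r a b} : ℝ)},
    filter_subset _ _, ?_, ?_, ?_⟩
  · have h1 : (#{a ∈ N | ¬ (#{a' ∈ N | common a a' < τ} : ℝ) ≤ δ / 8 * #N} : ℝ) * (δ / 8 * #N) ≤
        δ / 16 * #N ^ 2 := by
      refine le_trans ?_ hbadsum
      rw [← nsmul_eq_mul]
      refine (card_nsmul_le_sum _ _ _ fun a ha => (not_le.1 (mem_filter.1 ha).2).le).trans ?_
      exact sum_le_sum_of_subset_of_nonneg (filter_subset _ _) fun _ _ _ => by positivity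
    have h2 : (#{a ∈ N | ¬ (#{a' ∈ N | common a a' < τ} : ℝ) ≤ δ / 8 * #N} : ℝ) ≤ #N / 2 := by
      refine le_of_mul_le_mul_right ?_ (show 0 < δ / 8 * #N by positivity)
      linarith
    have h3 := card_filter_add_card_filter_not (s := N)
      (fun a => (#{a' ∈ N | common a a' < τ} : ℝ) ≤ δ / 8 * #N)
    have h4 : (#{a ∈ N | (#{a' ∈ N | common a a' < τ} : ℝ) ≤ δ / 8 * #N} : ℝ) +
        #{a ∈ N | ¬ (#{a' ∈ N | common a a' < τ} : ℝ) ≤ δ / 8 * #N} = #N := by exact_mod_cast h3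
    linarith
  · have h1 : #N * (δ / 2 * #B) ≤ ∑ b ∈ B, (#{a ∈ N | r a b} : ℝ) := by
      rw [← double_count, ← nsmul_eq_mul]
      exact card_nsmul_le_sum _ _ _ fun a ha => (mem_filter.1 (hNA₁ ha)).2
    have h2 := sum_sub_card_mul_le_sum_filter B (fun b => (#{a ∈ N | r a b} : ℝ))
      (t := δ / 4 * #N) (by positivity)
    have h3 : ∑ b ∈ B with δ / 4 * #N ≤ (#{a ∈ N | r a b} : ℝ), (#{a ∈ N | r a b} : ℝ) ≤
        #{b ∈ B | δ / 4 * #N ≤ (#{a ∈ N | r a b} : ℝ)} * #N := by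
      rw [← nsmul_eq_mul]
      exact sum_le_card_nsmul _ _ _ fun b _ => by gcongr; exact filter_subset _ _
    refine le_of_mul_le_mul_right ?_ hNpos
    linarith
  · intro a ha b hb
    have ha := (mem_filter.1 ha).2
    have hb := (mem_filter.1 hb).2
    set M : Finset α := {a' ∈ N | r a' b ∧ τ ≤ common a a'} with hM
    have hMcard : δ / 8 * #N ≤ (#M : ℝ) := by
      have h1 : {a' ∈ N | r a' b} ⊆ M ∪ {a' ∈ N | common a a' < τ} := by
        intro x hx
        simp only [hM, mem_union, mem_filter] at hx ⊢
        rcases le_or_gt τ (common a x) with h | h <;> tauto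
      have h2 : (#{a' ∈ N | r a' b} : ℝ) ≤ #M + #{a' ∈ N | common a a' < τ} := by
        exact_mod_cast (card_le_card h1).trans (card_union_le _ _)
      linarith
    have h1 : #M * τ ≤ (#{p ∈ M ×ˢ B | r a p.2 ∧ r p.1 p.2} : ℝ) := by
      have h2 : #{p ∈ M ×ˢ B | r a p.2 ∧ r p.1 p.2} =
          ∑ a' ∈ M, #{b' ∈ B | r a b' ∧ r a' b'} := by
        simp only [card_filter, sum_product]
      rw [h2, Nat.cast_sum, ← nsmul_eq_mul]
      exact card_nsmul_le_sum _ _ _ fun a' ha' => (mem_filter.1 ha').2.2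
    have h2 : {p ∈ M ×ˢ B | r a p.2 ∧ r p.1 p.2} ⊆
        {p ∈ A ×ˢ B | r a p.2 ∧ r p.1 p.2 ∧ r p.1 b} := by
      intro p hp
      simp only [hM, mem_filter, mem_product] at hp ⊢
      exact ⟨⟨hA₁A (hNA₁ hp.1.1.1), hp.1.2⟩, hp.2.1, hp.2.2, hp.1.1.2.1⟩
    calc δ ^ 5 * #A * #B / 3072 = δ / 8 * (δ * #A / 3) * τ := by rw [hτ]; ring
      _ ≤ δ / 8 * #N * τ := by gcongr
      _ ≤ #M * τ := by gcongr
      _ ≤ _ := h1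
      _ ≤ _ := by gcongr

open Finset in
/-- Each path `a, b', a', b` represents `a + b` as `(a + b') - (a' + b') + (a' + b)`. -/
lemma card_add_mul_le_card_pow_three {Z : Type*} [AddCommGroup Z] [DecidableEq Z]
    {A B A' B' : Finset Z} {G : Finset (Z × Z)} {m : ℝ}
    (h : ∀ a ∈ A', ∀ b ∈ B',
      m ≤ #{p ∈ A ×ˢ B | (a, p.2) ∈ G ∧ (p.1, p.2) ∈ G ∧ (p.1, b) ∈ G}) :
    #(A' + B') * m ≤ (#(G.image fun ab => ab.1 + ab.2) : ℝ) ^ 3 := by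
  set S := G.image fun ab => ab.1 + ab.2 with hS
  have hmem {x y : Z} (hxy : (x, y) ∈ G) : x + y ∈ S := mem_image_of_mem (fun ab => ab.1 + ab.2) hxy
  have hfib : ∀ x ∈ A' + B', m ≤ #{q ∈ S ×ˢ S ×ˢ S | q.1 - q.2.1 + q.2.2 = x} := by
    intro x hx
    obtain ⟨a, ha, b, hb, rfl⟩ := mem_add.1 hx
    refine (h a ha b hb).trans ?_
    norm_cast
    refine card_le_card_of_injOn (fun p => (a + p.2, p.1 + p.2, p.1 + b)) ?_ ?_
    · intro p hp
      simp only [coe_filter, mem_product, Set.mem_ofPred_eq] at hp ⊢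
      exact ⟨⟨hmem hp.2.1, hmem hp.2.2.1, hmem hp.2.2.2⟩, by abel⟩
    · rintro ⟨p, q⟩ - ⟨p', q'⟩ - hpq
      simp only [Prod.mk.injEq, add_right_inj, add_left_inj] at hpq ⊢
      exact ⟨hpq.2.2, hpq.1⟩
  have h1 := card_nsmul_le_sum _ _ _ hfib
  rw [nsmul_eq_mul] at h1
  refine h1.trans ?_
  have h2 : ∑ x ∈ A' + B', #{q ∈ S ×ˢ S ×ˢ S | q.1 - q.2.1 + q.2.2 = x} ≤ #(S ×ˢ S ×ˢ S) := by
    rw [sum_card_fiberwise_eq_card_filter]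
    exact card_filter_le _ _
  have h3 : #(S ×ˢ S ×ˢ S) = #S ^ 3 := by simp only [card_product]; ring
  rw [h3] at h2
  exact_mod_cast h2

open Finset in
/-- Small sumset implies small difference set. -/
lemma card_sub_mul_card_mul_card_le_card_add_pow_three {Z : Type*} [AddCommGroup Z] [DecidableEq Z]
    {A B : Finset Z} (hA : A.Nonempty) :
    (#(A - B) * (#A * #B) : ℝ) ≤ (#(A + B) : ℝ) ^ 3 := by
  have hA0 : (0 : ℝ) < #A := by exact_mod_cast hA.card_pos
  have h1 : (#(B + B) : ℝ) ≤ ((#(A + B) : ℝ) / #A) ^ 2 * #A := by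
    have h := pluennecke_ruzsa_inequality_nsmul_add hA B 2
    rw [two_nsmul] at h
    have h' := NNRat.cast_mono (K := ℝ) h
    push_cast at h'
    exact h'
  have h2 : (#(A - B) * #B : ℝ) ≤ #(A + B) * #(B + B) := by
    exact_mod_cast ruzsa_triangle_inequality_sub_add_add A B B
  have h3 : ((#(A + B) : ℝ) / #A) ^ 2 * #A * #A = (#(A + B) : ℝ) ^ 2 := by field_simp
  calc (#(A - B) * (#A * #B) : ℝ) = #(A - B) * #B * #A := by ring
    _ ≤ #(A + B) * #(B + B) * #A := by gcongr
    _ ≤ #(A + B) * (((#(A + B) : ℝ) / #A) ^ 2 * #A) * #A := by gcongr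
    _ = (#(A + B) : ℝ) ^ 3 := by rw [mul_assoc, h3]; ring

theorem balog_szemeredi_gowers :
    ∃ C : ℝ, 1 ≤ C ∧ ∃ c : ℝ, 0 < c ∧
      ∀ (Z : Type*) [AddCommGroup Z] [DecidableEq Z] (A B : Finset Z),
        A.card = B.card →
        ∀ K : ℝ, 1 ≤ K →
          ∀ G : Finset (Z × Z), G ⊆ A ×ˢ B →
            (A.card : ℝ) * B.card / K ≤ (G.card : ℝ) →
            ((G.image fun ab => ab.1 + ab.2).card : ℝ) ≤ K * A.card →
            ∃ A' : Finset Z, A' ⊆ A ∧ ∃ B' : Finset Z, B' ⊆ B ∧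
              c * K ^ (-C) * A.card ≤ (A'.card : ℝ) ∧
              c * K ^ (-C) * B.card ≤ (B'.card : ℝ) ∧
              ((A' - B').card : ℝ) ≤ C * K ^ C * A.card := by
  refine ⟨24 * 3072 ^ 3, by norm_num, 1 / 6, by norm_num, ?_⟩
  intro Z _ _ A B hAB K hK G hG hGcard hsum
  have hK0 : 0 < K := by linarith
  rcases A.eq_empty_or_nonempty with rfl | hA
  · obtain rfl : B = ∅ := by simpa using hAB.symm
    exact ⟨∅, subset_rfl, ∅, subset_rfl, by simp⟩
  have hB : B.Nonempty := by rw [← Finset.card_pos, ← hAB]; exact hA.card_pos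
  have hedges : K⁻¹ * A.card * B.card ≤
      ∑ a ∈ A, ((B.filter fun b => (a, b) ∈ G).card : ℝ) := by
    have h1 : ∑ a ∈ A, (B.filter fun b => (a, b) ∈ G).card = G.card := by
      conv_rhs => rw [← Finset.inter_eq_right.2 hG, ← Finset.filter_mem_eq_inter]
      simp only [Finset.card_filter, Finset.sum_product]
    rw [← Nat.cast_sum, h1]
    refine le_trans (le_of_eq ?_) hGcard
    field_simp
  obtain ⟨A', hA', B', hB', hA'card, hB'card, hpaths⟩ :=
    exists_subsets_many_paths A B (fun a b => (a, b) ∈ G) hA hB (inv_pos.2 hK0) hedges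
  have hsumset := card_add_mul_le_card_pow_three hpaths
  rw [← hAB] at hB'card hsumset ⊢
  set n : ℝ := (A.card : ℝ)
  have hn : 0 < n := by simpa [n] using hA.card_pos
  have hA'ne : A'.Nonempty := by
    have : (0 : ℝ) < A'.card := lt_of_lt_of_le (by positivity) hA'card
    exact Finset.card_pos.1 (by exact_mod_cast this)
  have hdiff := card_sub_mul_card_mul_card_le_card_add_pow_three (B := B') hA'ne
  have hpow : K ^ (-(24 * 3072 ^ 3) : ℝ) ≤ K⁻¹ := by
    rw [← Real.rpow_neg_one]
    exact Real.rpow_le_rpow_of_exponent_le hK (by norm_num)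
  have hpow' : K ^ 26 ≤ K ^ (24 * 3072 ^ 3 : ℝ) := by
    rw [← Real.rpow_natCast]
    exact Real.rpow_le_rpow_of_exponent_le hK (by norm_num)
  refine ⟨A', hA', B', hB', ?_, ?_, ?_⟩
  · calc _ ≤ 1 / 6 * K⁻¹ * n := by gcongr
      _ = K⁻¹ * n / 6 := by ring
      _ ≤ _ := hA'card
  · calc _ ≤ 1 / 6 * K⁻¹ * n := by gcongr
      _ ≤ K⁻¹ * n / 4 := by have : 0 < K⁻¹ * n := by positivity
                            linarith
      _ ≤ _ := hB'card
  · have hsumset' : ((A' + B').card : ℝ) ≤ 3072 * K ^ 8 * n := by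
      have h1 : ((A' + B').card : ℝ) * (K⁻¹ ^ 5 * n * n / 3072) ≤ (K * n) ^ 3 :=
        hsumset.trans (by gcongr)
      refine le_of_mul_le_mul_right (h1.trans (le_of_eq ?_))
        (show 0 < K⁻¹ ^ 5 * n * n / 3072 by positivity)
      field_simp
    have h2 : ((A' - B').card : ℝ) * ((K⁻¹ * n / 6) * (K⁻¹ * n / 4)) ≤ (3072 * K ^ 8 * n) ^ 3 :=
      calc _ ≤ ((A' - B').card : ℝ) * (A'.card * B'.card) := by gcongr
        _ ≤ _ := hdiff
        _ ≤ _ := by gcongr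
    have h3 : ((A' - B').card : ℝ) ≤ 24 * 3072 ^ 3 * K ^ 26 * n := by
      refine le_of_mul_le_mul_right (h2.trans (le_of_eq ?_))
        (show 0 < (K⁻¹ * n / 6) * (K⁻¹ * n / 4) by positivity)
      field_simp
      ring
    exact h3.trans (by gcongr)
end
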